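/- arXiv:1706.00126 — 2 statements merged into one kernel-verified Lean document; each statement's English description precedes it below -/
import Mathlib

section
/- Let D be a vertex-weighted oriented graph. If the underlying graph G of D is a complete graph and D has no oriented cycles (i.e., D is a weighted acyclic tournament), then the edge ideal I(D) is Cohen–Macaulay. -/
open MvPolynomial

noncomputable section

open RingTheory.Sequence in
/-- A (graded) ideal `I` of `R = K[x_1, …, x_n]` is Cohen–Macaulay if `R/I` is a
Cohen–Macaulay ring, i.e. there is a regular sequence on `R/I`, contained in the irrelevant
maximal ideal `(x_1, …, x_n)`, whose length equals the Krull dimension of `R/I`. -/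
def IsCohenMacaulayIdeal {n : ℕ} {K : Type*} [Field K]
    (I : Ideal (MvPolynomial (Fin n) K)) : Prop :=
  ∃ rs : List (MvPolynomial (Fin n) K),
    (∀ f ∈ rs, f ∈ Ideal.span (Set.range (X : Fin n → MvPolynomial (Fin n) K))) ∧
    IsRegular (MvPolynomial (Fin n) K ⧸ I) rs ∧
    (rs.length : WithBot ℕ∞) = ringKrullDim (MvPolynomial (Fin n) K ⧸ I)

/-- A vertex-weighted oriented graph on the vertex set `{x_1, …, x_n}`: a digraph with no
loops and no oriented cycles of length two, together with a positive integer weight `d i`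
attached to each vertex. -/
structure WOG (n : ℕ) where
  E : Fin n → Fin n → Prop
  irrefl : ∀ i, ¬ E i i
  no_two_cycles : ∀ i j, E i j → ¬ E j i
  d : Fin n → ℕ
  dpos : ∀ i, 1 ≤ d i

/-- The edge ideal `I(D) = (x_i x_j^{d_j} : (x_i, x_j) ∈ E(D))` of a vertex-weighted
oriented graph `D`. -/
def edgeIdeal (K : Type*) [Field K] {n : ℕ} (D : WOG n) : Ideal (MvPolynomial (Fin n) K) :=
  Ideal.span {f | ∃ i j, D.E i j ∧ f = X i * (X j : MvPolynomial (Fin n) K) ^ D.d j}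

section KrullDim

variable {σ K : Type*} [Field K]

/-- If all products of two distinct variables are nilpotent modulo `I`, then the quotient by `I`
has Krull dimension at most one. -/
theorem krullDimLE_one_quotient_of_X_mul_X_mem_radical [Nonempty σ]
    (I : Ideal (MvPolynomial σ K))
    (h : ∀ i j, i ≠ j → (X i * X j : MvPolynomial σ K) ∈ I.radical) :
    Ring.KrullDimLE 1 (MvPolynomial σ K ⧸ I) := by
  classical
  refine Ring.krullDimLE_one_iff.2 fun p hp => or_iff_not_imp_left.2 fun hmin => ?_
  obtain ⟨q, hq, hqp, hne⟩ : ∃ q : Ideal (MvPolynomial σ K ⧸ I), q.IsPrime ∧ q ≤ p ∧ ¬ p ≤ q := by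
    by_contra! hcon
    exact hmin ⟨⟨hp, bot_le⟩, fun q hq hqp => hcon q hq.1 hqp⟩
  let mk := Ideal.Quotient.mk I
  have hmk : Function.Surjective mk := Ideal.Quotient.mk_surjective
  have hIq : I.radical ≤ q.comap mk := by
    refine (hq.comap mk).radical_le_iff.2 fun f hf => ?_
    simp [Ideal.mem_comap, mk, Ideal.Quotient.eq_zero_iff_mem.2 hf]
  obtain ⟨k, hk⟩ : ∃ k, ∀ i, i ≠ k → (X i : MvPolynomial σ K) ∈ q.comap mk := by
    by_cases hall : ∀ i, (X i : MvPolynomial σ K) ∈ q.comap mk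
    · exact ⟨Classical.arbitrary σ, fun i _ => hall i⟩
    · push Not at hall
      obtain ⟨k, hk⟩ := hall
      exact ⟨k, fun i hi => ((hq.comap mk).mem_or_mem (hIq (h i k hi))).resolve_right hk⟩
  let α : Polynomial K →ₐ[K] MvPolynomial σ K := Polynomial.aeval (X k)
  let β : MvPolynomial σ K →ₐ[K] Polynomial K := aeval fun i => if i = k then Polynomial.X else 0
  have hαβ (g : MvPolynomial σ K) : mk (α (β g)) - mk g ∈ q := by
    rw [← Ideal.Quotient.eq]
    have : ((Ideal.Quotient.mkₐ K q).comp (Ideal.Quotient.mkₐ K I)).comp (α.comp β) =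
        (Ideal.Quotient.mkₐ K q).comp (Ideal.Quotient.mkₐ K I) := by
      refine MvPolynomial.algHom_ext fun i => ?_
      by_cases hi : i = k
      · simp [α, β, hi]
      · have := Ideal.Quotient.eq_zero_iff_mem.2 (Ideal.mem_comap.1 (hk i hi))
        simpa [α, β, hi] using this.symm
    exact DFunLike.congr_fun this g
  have hβ : Function.Surjective β := by
    intro f
    refine ⟨α f, ?_⟩
    have : β.comp α = AlgHom.id K _ := Polynomial.algHom_ext (by simp [α, β])
    exact DFunLike.congr_fun this f
  let P := p.comap (mk.comp α.toRingHom)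
  have hP : P.IsPrime := hp.comap _
  have hP0 : P ≠ ⊥ := by
    obtain ⟨g, hgp, hgq⟩ := SetLike.not_le_iff_exists.1 hne
    obtain ⟨g, rfl⟩ := hmk g
    intro hbot
    have hmem : β g ∈ P := (p.sub_mem_iff_left hgp).1 (hqp (hαβ g))
    rw [hbot, Ideal.mem_bot] at hmem
    have := hαβ g
    rw [hmem, map_zero, map_zero, zero_sub, neg_mem_iff] at this
    exact hgq this
  have hPmax : P.IsMaximal := hP.isMaximal hP0
  have hpP : p.comap mk = P.comap β.toRingHom := by
    ext g
    refine ⟨fun hg => ?_, fun hg => ?_⟩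
    · exact (p.sub_mem_iff_left hg).1 (hqp (hαβ g))
    · exact (p.sub_mem_iff_right hg).1 (hqp (hαβ g))
  have hmax : (p.comap mk).IsMaximal := by
    rw [hpP]
    exact Ideal.comap_isMaximal_of_surjective _ hβ
  rcases Ideal.map_eq_top_or_isMaximal_of_surjective mk hmk hmax with htop | hm
  · rw [Ideal.map_comap_of_surjective mk hmk] at htop
    exact absurd htop hp.ne_top
  · rwa [Ideal.map_comap_of_surjective mk hmk] at hm

end KrullDim

section PurePowers

variable {σ : Type*} (K : Type*) [Field K]

/-- The ideal generated by the pure powers `x_i ^ e_i` of all variables other than `x_k`. -/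
def purePowerIdeal (k : σ) (e : σ → ℕ) : Ideal (MvPolynomial σ K) :=
  Ideal.span ((fun m => monomial m (1 : K)) '' {m | ∃ i, i ≠ k ∧ m = Finsupp.single i (e i)})

variable {K}

theorem mem_purePowerIdeal {k : σ} {e : σ → ℕ} {g : MvPolynomial σ K} :
    g ∈ purePowerIdeal K k e ↔ ∀ m ∈ g.support, ∃ i, i ≠ k ∧ e i ≤ m i := by
  classical
  rw [purePowerIdeal, mem_ideal_span_monomial_image]
  refine forall₂_congr fun m _ => ⟨?_, ?_⟩
  · rintro ⟨_, ⟨i, hi, rfl⟩, hle⟩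
    exact ⟨i, hi, Finsupp.single_le_iff.1 hle⟩
  · rintro ⟨i, hi, hle⟩
    exact ⟨_, ⟨i, hi, rfl⟩, Finsupp.single_le_iff.2 hle⟩

theorem X_pow_mem_purePowerIdeal {k i : σ} (e : σ → ℕ) (hi : i ≠ k) :
    (X i ^ e i : MvPolynomial σ K) ∈ purePowerIdeal K k e :=
  Ideal.subset_span ⟨_, ⟨i, hi, rfl⟩, (X_pow_eq_monomial).symm⟩

theorem mem_purePowerIdeal_of_X_mul_mem {k : σ} {e : σ → ℕ} {g : MvPolynomial σ K}
    (h : X k * g ∈ purePowerIdeal K k e) : g ∈ purePowerIdeal K k e := by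
  classical
  rw [mem_purePowerIdeal] at h ⊢
  intro m hm
  obtain ⟨i, hi, hle⟩ := h (Finsupp.single k 1 + m) (by simpa [mem_support_iff] using hm)
  exact ⟨i, hi, by simpa [Finsupp.single_apply, hi.symm] using hle⟩

theorem mem_purePowerIdeal_of_X_pow_mul_mem {k : σ} {e : σ → ℕ} {g : MvPolynomial σ K} (N : ℕ)
    (h : X k ^ N * g ∈ purePowerIdeal K k e) : g ∈ purePowerIdeal K k e := by
  induction N with
  | zero => simpa using h
  | succ N ih => exact ih (mem_purePowerIdeal_of_X_mul_mem (by rwa [← mul_assoc, ← pow_succ']))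

theorem mem_purePowerIdeal_of_sum_X_mul_mem [Fintype σ] {k : σ} {e : σ → ℕ}
    {g : MvPolynomial σ K} (h : (∑ i, X i) * g ∈ purePowerIdeal K k e) :
    g ∈ purePowerIdeal K k e := by
  classical
  obtain ⟨N, hN⟩ : (X k - ∑ i, X i : MvPolynomial σ K) ∈ (purePowerIdeal K k e).radical := by
    rw [← Finset.add_sum_erase _ _ (Finset.mem_univ k), sub_add_cancel_left, neg_mem_iff]
    exact sum_mem fun i hi => ⟨e i, X_pow_mem_purePowerIdeal e (Finset.ne_of_mem_erase hi)⟩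
  obtain ⟨c, hc⟩ := sub_dvd_pow_sub_pow (X k : MvPolynomial σ K) (X k - ∑ i, X i) N
  rw [sub_sub_cancel, sub_eq_iff_eq_add] at hc
  refine mem_purePowerIdeal_of_X_pow_mul_mem N ?_
  rw [hc, add_mul, mul_right_comm]
  exact add_mem (Ideal.mul_mem_right _ _ h) (Ideal.mul_mem_right _ _ hN)

end PurePowers

section EdgeIdeal

variable {K : Type*} [Field K] {n : ℕ} {D : WOG n}

theorem mem_edgeIdeal {g : MvPolynomial (Fin n) K} :
    g ∈ edgeIdeal K D ↔ ∀ m ∈ g.support, ∃ i j, D.E i j ∧ 1 ≤ m i ∧ D.d j ≤ m j := by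
  classical
  have hspan : edgeIdeal K D = Ideal.span ((fun m => monomial m (1 : K)) ''
      {m | ∃ i j, D.E i j ∧ m = Finsupp.single i 1 + Finsupp.single j (D.d j)}) := by
    rw [edgeIdeal]
    congr 1
    ext f
    constructor
    · rintro ⟨i, j, hij, rfl⟩
      exact ⟨_, ⟨i, j, hij, rfl⟩, by
        rw [X_pow_eq_monomial, X, monomial_mul, one_mul]⟩
    · rintro ⟨_, ⟨i, j, hij, rfl⟩, rfl⟩
      exact ⟨i, j, hij, by rw [X_pow_eq_monomial, X, monomial_mul, one_mul]⟩
  rw [hspan, mem_ideal_span_monomial_image]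
  refine forall₂_congr fun m _ => ⟨?_, ?_⟩
  · rintro ⟨_, ⟨i, j, hij, rfl⟩, hle⟩
    have hi := hle i
    have hj := hle j
    simp only [Finsupp.add_apply, Finsupp.single_eq_same] at hi hj
    exact ⟨i, j, hij, by omega, by omega⟩
  · rintro ⟨i, j, hij, hi, hj⟩
    refine ⟨_, ⟨i, j, hij, rfl⟩, fun l => ?_⟩
    have hne : i ≠ j := fun h => D.irrefl j (h ▸ hij)
    by_cases hli : l = i
    · subst hli
      simpa [Finsupp.single_apply, hne.symm] using hi
    · by_cases hlj : l = j
      · subst hlj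
        simpa [Finsupp.single_apply, hne] using hj
      · simp [Ne.symm hli, Ne.symm hlj]

open Classical in
/-- The exponents of the `x_k`-primary component of the edge ideal of an acyclic tournament:
`1` at the vertices with an edge into `x_k` and the weight at all others. -/
def WOG.componentExp (D : WOG n) (k i : Fin n) : ℕ :=
  if D.E i k then 1 else D.d i

theorem WOG.one_le_componentExp (k i : Fin n) : 1 ≤ D.componentExp k i := by
  rw [WOG.componentExp]
  split_ifs
  exacts [le_rfl, D.dpos i]

theorem WOG.componentExp_le (k i : Fin n) : D.componentExp k i ≤ D.d i := by
  rw [WOG.componentExp]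
  split_ifs
  exacts [D.dpos i, le_rfl]

/-- A nonempty set of vertices of an acyclic oriented graph contains a source. -/
theorem WOG.exists_source (hacyclic : ∀ i : Fin n, ¬ Relation.TransGen D.E i i)
    {s : Set (Fin n)} (hs : s.Nonempty) : ∃ k ∈ s, ∀ i ∈ s, ¬ D.E i k := by
  have : Std.Irrefl (Relation.TransGen D.E) := ⟨hacyclic⟩
  obtain ⟨k, hk, hmin⟩ :=
    (Finite.wellFounded_of_trans_of_irrefl (Relation.TransGen D.E)).has_min s hs
  exact ⟨k, hk, fun i hi h => hmin i hi (.single h)⟩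

/-- The primary decomposition of the edge ideal of an acyclic tournament. -/
theorem mem_edgeIdeal_iff_forall_mem_purePowerIdeal [NeZero n]
    (hcomplete : ∀ i j : Fin n, i ≠ j → D.E i j ∨ D.E j i)
    (hacyclic : ∀ i : Fin n, ¬ Relation.TransGen D.E i i) {g : MvPolynomial (Fin n) K} :
    g ∈ edgeIdeal K D ↔ ∀ k, g ∈ purePowerIdeal K k (D.componentExp k) := by
  simp only [mem_edgeIdeal, mem_purePowerIdeal]
  rw [forall_comm]
  refine forall_congr' fun m => ?_
  rw [forall_comm]
  refine forall_congr' fun _ => ⟨?_, fun h => ?_⟩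
  · rintro ⟨i, j, hij, hi, hj⟩ k
    by_cases hjk : j = k
    · subst hjk
      refine ⟨i, fun h => D.irrefl j (h ▸ hij), ?_⟩
      rwa [WOG.componentExp, if_pos hij]
    · exact ⟨j, hjk, (D.componentExp_le k j).trans hj⟩
  · obtain ⟨i, -, hi⟩ := h 0
    have hi' : m i ≠ 0 := by have := D.one_le_componentExp 0 i; omega
    obtain ⟨k, hk, hsrc⟩ := D.exists_source hacyclic (s := {i | m i ≠ 0}) ⟨i, hi'⟩
    obtain ⟨j, hjk, hj⟩ := h k
    have hj' : m j ≠ 0 := by have := D.one_le_componentExp k j; omega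
    have hnot := hsrc j hj'
    rw [WOG.componentExp, if_neg hnot] at hj
    exact ⟨k, j, (hcomplete j k hjk).resolve_left hnot, Nat.one_le_iff_ne_zero.2 hk, hj⟩

theorem edgeIdeal_le_ker_constantCoeff :
    edgeIdeal K D ≤ RingHom.ker (constantCoeff : MvPolynomial (Fin n) K →+* K) := by
  refine Ideal.span_le.2 ?_
  rintro _ ⟨i, j, -, rfl⟩
  simp [RingHom.mem_ker]

theorem X_mul_X_mem_radical_edgeIdeal
    (hcomplete : ∀ i j : Fin n, i ≠ j → D.E i j ∨ D.E j i) {i j : Fin n} (hij : i ≠ j) :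
    (X i * X j : MvPolynomial (Fin n) K) ∈ (edgeIdeal K D).radical := by
  have key {i j : Fin n} (h : D.E i j) :
      (X i * X j : MvPolynomial (Fin n) K) ∈ (edgeIdeal K D).radical := by
    refine ⟨D.d j, ?_⟩
    have hmem : (X i * X j ^ D.d j : MvPolynomial (Fin n) K) ∈ edgeIdeal K D :=
      Ideal.subset_span ⟨i, j, h, rfl⟩
    rw [mul_pow]
    exact Ideal.mem_of_dvd _ (mul_dvd_mul_right (dvd_pow_self _ (Nat.one_le_iff_ne_zero.1 (D.dpos j))) _) hmem
  rcases hcomplete i j hij with h | h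
  · exact key h
  · rw [mul_comm]
    exact key h

end EdgeIdeal

/-- If the underlying graph of a vertex-weighted oriented graph `D` is
complete and `D` has no oriented cycles (i.e. `D` is a weighted acyclic tournament), then the
edge ideal `I(D)` is Cohen–Macaulay. -/
theorem edgeIdeal_cm_of_acyclic_tournament
    {n : ℕ} (K : Type*) [Field K] (D : WOG n)
    (hcomplete : ∀ i j : Fin n, i ≠ j → D.E i j ∨ D.E j i)
    (hacyclic : ∀ i : Fin n, ¬ Relation.TransGen D.E i i) :
    IsCohenMacaulayIdeal (edgeIdeal K D) := by
  rcases Nat.eq_zero_or_pos n with rfl | hn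
  · have hbot : edgeIdeal K D = ⊥ := by
      rw [edgeIdeal, Ideal.span_eq_bot]
      rintro _ ⟨i, -⟩
      exact i.elim0
    have hnt : Nontrivial (MvPolynomial (Fin 0) K ⧸ edgeIdeal K D) :=
      Ideal.Quotient.nontrivial_iff.2 (by rw [hbot]; exact bot_ne_top)
    refine ⟨[], by simp, RingTheory.Sequence.IsRegular.nil _ _, ?_⟩
    rw [ringKrullDim_eq_of_ringEquiv ((Ideal.quotEquivOfEq hbot).trans
      ((RingEquiv.quotientBot _).trans (isEmptyRingEquiv K (Fin 0)))),
      ringKrullDim_eq_zero_of_field]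
    simp
  have : NeZero n := ⟨hn.ne'⟩
  set I := edgeIdeal K D with hI
  let f : MvPolynomial (Fin n) K := ∑ i, X i
  have hf0 : constantCoeff f = 0 := by simp [f]
  have hreg (g : MvPolynomial (Fin n) K) (h : f * g ∈ I) : g ∈ I := by
    rw [hI, mem_edgeIdeal_iff_forall_mem_purePowerIdeal hcomplete hacyclic] at h ⊢
    exact fun k => mem_purePowerIdeal_of_sum_X_mul_mem (h k)
  have hone (g : MvPolynomial (Fin n) K) : f * g - 1 ∉ I := fun h => by
    simpa [RingHom.mem_ker, hf0] using edgeIdeal_le_ker_constantCoeff h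
  have hnzd : Ideal.Quotient.mk I f ∈ nonZeroDivisors (MvPolynomial (Fin n) K ⧸ I) := by
    rw [mem_nonZeroDivisors_iff_left]
    intro g hg
    obtain ⟨g, rfl⟩ := Ideal.Quotient.mk_surjective g
    rw [← map_mul, Ideal.Quotient.eq_zero_iff_mem] at hg
    exact Ideal.Quotient.eq_zero_iff_mem.2 (hreg g hg)
  refine ⟨[f], ?_, ?_, ?_⟩
  · simp only [List.mem_singleton, forall_eq]
    exact sum_mem fun i _ => Ideal.subset_span ⟨i, rfl⟩
  · refine ⟨?_, fun htop => ?_⟩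
    · rw [RingTheory.Sequence.isWeaklyRegular_singleton_iff, isSMulRegular_iff_right_eq_zero_of_smul]
      intro g hg
      refine (mem_nonZeroDivisors_iff_left.1 hnzd) g ?_
      obtain ⟨g, rfl⟩ := Ideal.Quotient.mk_surjective g
      exact hg
    · have hmem : (1 : MvPolynomial (Fin n) K ⧸ I) ∈
          Ideal.ofList [f] • (⊤ : Submodule (MvPolynomial (Fin n) K) (MvPolynomial (Fin n) K ⧸ I)) :=
        htop ▸ Submodule.mem_top
      rw [Ideal.ofList_singleton, Submodule.ideal_span_singleton_smul,
        Submodule.mem_smul_pointwise_iff_exists] at hmem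
      obtain ⟨g, -, hg⟩ := hmem
      obtain ⟨g, rfl⟩ := Ideal.Quotient.mk_surjective g
      exact hone g (Ideal.Quotient.eq.1 hg)
  · refine le_antisymm ?_ ?_
    · refine le_trans ?_ (ringKrullDim_quotient_succ_le_of_nonZeroDivisor hnzd)
      have : Nontrivial ((MvPolynomial (Fin n) K ⧸ I) ⧸ Ideal.span {Ideal.Quotient.mk I f}) := by
        rw [Ideal.Quotient.nontrivial_iff, Ne, Ideal.span_singleton_eq_top, isUnit_iff_exists_inv]
        rintro ⟨g, hg⟩
        obtain ⟨g, rfl⟩ := Ideal.Quotient.mk_surjective g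
        exact hone g (Ideal.Quotient.eq.1 (by rwa [map_mul, map_one]))
      simpa using add_le_add_left (ringKrullDim_nonneg_of_nontrivial (R := _ ⧸ _)) 1
    · exact Ring.krullDimLE_iff.1 (krullDimLE_one_quotient_of_X_mul_X_mem_radical I
        fun i j => X_mul_X_mem_radical_edgeIdeal hcomplete)
end
end

section
/- If D is a transitive vertex-weighted oriented graph and I = I(D) is its edge ideal, then Alexander duality holds for I, that is, I* = I^∨. -/
open MvPolynomial

noncomputable section

/-- An irreducible monomial ideal: an ideal of the form `(x_{i₁}^{a₁}, …, x_{i_r}^{a_r})`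
with all exponents `a_j ≥ 1`. -/
def IsIrreducibleMonomialIdeal {n : ℕ} {K : Type*} [Field K]
    (L : Ideal (MvPolynomial (Fin n) K)) : Prop :=
  ∃ (s : Finset (Fin n)) (a : Fin n → ℕ), (∀ i ∈ s, 1 ≤ a i) ∧
    L = Ideal.span ((fun i => (X i : MvPolynomial (Fin n) K) ^ a i) '' ↑s)

/-- `L` is a minimal irreducible monomial ideal of `I`: `L` is an irreducible monomial ideal
containing `I`, and every irreducible monomial ideal squeezed between `I` and `L` equals `L`. -/
def IsMinimalIrreducibleOf {n : ℕ} {K : Type*} [Field K]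
    (I L : Ideal (MvPolynomial (Fin n) K)) : Prop :=
  IsIrreducibleMonomialIdeal L ∧ I ≤ L ∧
    ∀ L' : Ideal (MvPolynomial (Fin n) K),
      IsIrreducibleMonomialIdeal L' → I ≤ L' → L' ≤ L → L' = L

/-- The irreducible monomial ideal `({x_i^{a_i} : a_i ≥ 1})` attached to an exponent
vector `a`. -/
def pureIdeal {n : ℕ} (K : Type*) [Field K] (a : Fin n →₀ ℕ) :
    Ideal (MvPolynomial (Fin n) K) :=
  Ideal.span {g | ∃ i, 1 ≤ a i ∧ g = (X i : MvPolynomial (Fin n) K) ^ a i}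

/-- The Alexander dual `I^∨` of a monomial ideal `I`: the ideal generated by the monomials
`x^a` such that `{x_i^{a_i} : a_i ≥ 1}` generates a minimal irreducible monomial ideal
of `I` (i.e. the products of the minimal generators of the irreducible components of `I`). -/
def alexDual {n : ℕ} {K : Type*} [Field K] (I : Ideal (MvPolynomial (Fin n) K)) :
    Ideal (MvPolynomial (Fin n) K) :=
  Ideal.span {f | ∃ a : Fin n →₀ ℕ,
    IsMinimalIrreducibleOf I (pureIdeal K a) ∧ f = monomial a (1 : K)}

/-- A polynomial lies in `pureIdeal K a` iff each of its monomials is divisible by one of the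
generators. -/
theorem mem_pureIdeal_iff {n : ℕ} {K : Type*} [Field K] {a : Fin n →₀ ℕ}
    {f : MvPolynomial (Fin n) K} :
    f ∈ pureIdeal K a ↔ ∀ m ∈ f.support, ∃ i, 1 ≤ a i ∧ a i ≤ m i := by
  have h : pureIdeal K a = Ideal.span ((fun s => monomial s (1 : K)) ''
      {s | ∃ i, 1 ≤ a i ∧ s = Finsupp.single i (a i)}) := by
    unfold pureIdeal
    congr 1
    ext g
    constructor
    · rintro ⟨i, hi, rfl⟩
      exact ⟨_, ⟨i, hi, rfl⟩, (X_pow_eq_monomial).symm⟩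
    · rintro ⟨_, ⟨i, hi, rfl⟩, rfl⟩
      exact ⟨i, hi, (X_pow_eq_monomial).symm⟩
  rw [h, mem_ideal_span_monomial_image]
  simp

theorem monomial_mem_pureIdeal_iff {n : ℕ} {K : Type*} [Field K] {a m : Fin n →₀ ℕ} :
    monomial m (1 : K) ∈ pureIdeal K a ↔ ∃ i, 1 ≤ a i ∧ a i ≤ m i := by
  classical
  rw [mem_pureIdeal_iff, support_monomial]
  simp

theorem pureIdeal_le_pureIdeal_iff {n : ℕ} {K : Type*} [Field K] {a b : Fin n →₀ ℕ} :
    pureIdeal K a ≤ pureIdeal K b ↔ ∀ i, 1 ≤ a i → 1 ≤ b i ∧ b i ≤ a i := by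
  constructor
  · intro h i hi
    have hmem : monomial (Finsupp.single i (a i)) (1 : K) ∈ pureIdeal K b :=
      h (Ideal.subset_span ⟨i, hi, (X_pow_eq_monomial).symm⟩)
    obtain ⟨k, hk, hk'⟩ := monomial_mem_pureIdeal_iff.1 hmem
    obtain rfl | hik := eq_or_ne i k
    · rw [Finsupp.single_eq_same] at hk'
      exact ⟨hk, hk'⟩
    · rw [Finsupp.single_eq_of_ne' hik] at hk'
      omega
  · intro h f hf
    rw [mem_pureIdeal_iff] at hf ⊢
    intro m hm
    obtain ⟨i, hi, him⟩ := hf m hm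
    exact ⟨i, (h i hi).1, (h i hi).2.trans him⟩

theorem isIrreducibleMonomialIdeal_iff {n : ℕ} {K : Type*} [Field K]
    {L : Ideal (MvPolynomial (Fin n) K)} :
    IsIrreducibleMonomialIdeal L ↔ ∃ a : Fin n →₀ ℕ, L = pureIdeal K a := by
  constructor
  · rintro ⟨s, a, ha, rfl⟩
    refine ⟨Finsupp.equivFunOnFinite.symm fun i => if i ∈ s then a i else 0, ?_⟩
    unfold pureIdeal
    congr 1
    ext g
    constructor
    · rintro ⟨i, hi, rfl⟩
      have hi' : i ∈ s := hi
      exact ⟨i, by simp [hi', ha i hi'], by simp [hi']⟩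
    · rintro ⟨i, hi, rfl⟩
      have hi' : i ∈ s := by
        by_contra h
        simp [h] at hi
      exact ⟨i, hi', by simp [hi']⟩
  · rintro ⟨a, rfl⟩
    refine ⟨a.support, a, fun i hi => Nat.one_le_iff_ne_zero.2 (Finsupp.mem_support_iff.1 hi), ?_⟩
    unfold pureIdeal
    congr 1
    ext g
    constructor
    · rintro ⟨i, hi, rfl⟩
      exact ⟨i, by simpa using Nat.one_le_iff_ne_zero.1 hi, rfl⟩
    · rintro ⟨i, hi, rfl⟩
      exact ⟨i, Nat.one_le_iff_ne_zero.2 (by simpa using hi), rfl⟩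

theorem exists_le_single_add_single_iff {n : ℕ} {i j : Fin n} (hij : i ≠ j) {d : ℕ}
    (hd : 1 ≤ d) {m : Fin n →₀ ℕ} :
    (∃ k, 1 ≤ (Finsupp.single i 1 + Finsupp.single j d : Fin n →₀ ℕ) k ∧
      (Finsupp.single i 1 + Finsupp.single j d : Fin n →₀ ℕ) k ≤ m k) ↔ 1 ≤ m i ∨ d ≤ m j := by
  constructor
  · rintro ⟨k, hk, hk'⟩
    simp only [Finsupp.add_apply, Finsupp.single_apply] at hk hk'
    grind
  · rintro (h | h)
    · exact ⟨i, by simp [hij.symm, h]⟩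
    · exact ⟨j, by simp [hij, hd, h]⟩

theorem exists_single_add_single_ge_iff {n : ℕ} {i j : Fin n} (hij : i ≠ j) {d : ℕ}
    {a : Fin n →₀ ℕ} :
    (∃ k, 1 ≤ a k ∧ a k ≤ (Finsupp.single i 1 + Finsupp.single j d : Fin n →₀ ℕ) k) ↔
      a i = 1 ∨ (1 ≤ a j ∧ a j ≤ d) := by
  constructor
  · rintro ⟨k, hk, hk'⟩
    simp only [Finsupp.add_apply, Finsupp.single_apply] at hk'
    grind
  · rintro (h | h)
    · exact ⟨i, by simp [hij.symm, h]⟩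
    · exact ⟨j, by simp [hij, h]⟩

namespace WOG

variable {n : ℕ} (D : WOG n)

theorem ne_of_edge {i j : Fin n} (h : D.E i j) : i ≠ j := by
  rintro rfl
  exact D.irrefl _ h

theorem edgeIdeal_le_pureIdeal_iff {K : Type*} [Field K] {a : Fin n →₀ ℕ} :
    edgeIdeal K D ≤ pureIdeal K a ↔
      ∀ i j, D.E i j → a i = 1 ∨ (1 ≤ a j ∧ a j ≤ D.d j) := by
  have hmon : ∀ i j, (X i * X j ^ D.d j : MvPolynomial (Fin n) K) =
      monomial (Finsupp.single i 1 + Finsupp.single j (D.d j)) 1 := fun i j => by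
    rw [X_pow_eq_monomial, X, monomial_mul, one_mul]
  unfold edgeIdeal
  rw [Ideal.span_le]
  constructor
  · intro h i j hij
    have := h ⟨i, j, hij, rfl⟩
    rwa [hmon, SetLike.mem_coe, monomial_mem_pureIdeal_iff,
      exists_single_add_single_ge_iff (D.ne_of_edge hij)] at this
  · rintro h _ ⟨i, j, hij, rfl⟩
    rw [hmon, SetLike.mem_coe, monomial_mem_pureIdeal_iff,
      exists_single_add_single_ge_iff (D.ne_of_edge hij)]
    exact h i j hij

/-- Below every irreducible ideal containing the edge ideal there is an irreducible component,
and its exponents are bounded by the weights. -/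
theorem exists_isMinimalIrreducibleOf_le {K : Type*} [Field K] {a : Fin n →₀ ℕ}
    (ha : edgeIdeal K D ≤ pureIdeal K a) :
    ∃ c : Fin n →₀ ℕ, IsMinimalIrreducibleOf (edgeIdeal K D) (pureIdeal K c) ∧
      pureIdeal K c ≤ pureIdeal K a ∧ ∀ i, c i ≤ D.d i := by
  have htrunc : ∀ c : Fin n →₀ ℕ, edgeIdeal K D ≤ pureIdeal K c → ∃ c' : Fin n →₀ ℕ,
      edgeIdeal K D ≤ pureIdeal K c' ∧ pureIdeal K c' ≤ pureIdeal K c ∧ ∀ i, c' i ≤ D.d i := by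
    intro c hc
    rw [edgeIdeal_le_pureIdeal_iff] at hc
    refine ⟨Finsupp.equivFunOnFinite.symm fun i => if c i ≤ D.d i then c i else 0, ?_, ?_, ?_⟩
    · rw [edgeIdeal_le_pureIdeal_iff]
      intro i j hij
      have := D.dpos i
      simp only [Finsupp.equivFunOnFinite_symm_apply_apply]
      grind
    · rw [pureIdeal_le_pureIdeal_iff]
      intro i
      simp only [Finsupp.equivFunOnFinite_symm_apply_apply]
      grind
    · intro i
      simp only [Finsupp.equivFunOnFinite_symm_apply_apply]
      grind
  let S : Set (Fin n →₀ ℕ) := {c | edgeIdeal K D ≤ pureIdeal K c ∧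
    pureIdeal K c ≤ pureIdeal K a ∧ ∀ i, c i ≤ D.d i}
  have hfin : S.Finite := (Set.finite_Iic (Finsupp.equivFunOnFinite.symm D.d)).subset
    fun c hc i => hc.2.2 i
  obtain ⟨c, hc, hmin⟩ := hfin.exists_minimalFor (pureIdeal K) S (htrunc a ha)
  refine ⟨c, ⟨isIrreducibleMonomialIdeal_iff.2 ⟨c, rfl⟩, hc.1, ?_⟩, hc.2⟩
  intro L hL hIL hLc
  obtain ⟨b, rfl⟩ := isIrreducibleMonomialIdeal_iff.1 hL
  obtain ⟨b', hb', hbb, hbd⟩ := htrunc b hIL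
  have hbc := hbb.trans hLc
  exact le_antisymm hLc ((hmin ⟨hb', hbc.trans hc.2.1, hbd⟩ hbc).trans hbb)

/-- For a transitive `D`, exponent vectors of irreducible components of the edge ideal satisfy
the inequalities defining the dual. -/
theorem one_le_or_le_of_isMinimalIrreducibleOf {K : Type*} [Field K]
    (htrans : ∀ i j k : Fin n, D.E i j → D.E j k → i ≠ k → D.E i k) {a : Fin n →₀ ℕ}
    (ha : IsMinimalIrreducibleOf (edgeIdeal K D) (pureIdeal K a)) {i j : Fin n}
    (hij : D.E i j) : 1 ≤ a i ∨ D.d j ≤ a j := by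
  classical
  by_contra! hcon
  obtain ⟨hi, hj⟩ := hcon
  obtain ⟨-, hcov, hmin⟩ := ha
  have hcov' := D.edgeIdeal_le_pureIdeal_iff.1 hcov
  have hout : ∀ k, D.E i k → 1 ≤ a k ∧ a k ≤ D.d k := fun k hk =>
    (hcov' i k hk).resolve_left (by omega)
  have hj' := hout j hij
  let c : Fin n →₀ ℕ := a.update j (D.d j)
  have hcj : c j = D.d j := by simp [c]
  have hck : ∀ k, k ≠ j → c k = a k := fun k hk => by simp [c, hk]
  have hc : edgeIdeal K D ≤ pureIdeal K c := by
    rw [edgeIdeal_le_pureIdeal_iff]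
    intro k l hkl
    by_cases hl : l = j
    · subst hl
      right
      rw [hcj]
      exact ⟨D.dpos _, le_rfl⟩
    · rw [hck l hl]
      by_cases hk : k = j
      · subst hk
        refine Or.inr (hout l (htrans _ _ _ hij hkl ?_))
        rintro rfl
        exact D.no_two_cycles _ _ hij hkl
      · rw [hck k hk]
        exact hcov' k l hkl
  have hle : pureIdeal K c ≤ pureIdeal K a := by
    rw [pureIdeal_le_pureIdeal_iff]
    intro k hk
    by_cases hkj : k = j
    · subst hkj
      rw [hcj]
      exact hj'
    · rw [hck k hkj] at hk ⊢
      exact ⟨hk, le_rfl⟩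
  have heq := hmin _ (isIrreducibleMonomialIdeal_iff.2 ⟨c, rfl⟩) hc hle
  have := (pureIdeal_le_pureIdeal_iff.1 heq.ge j hj'.1).2
  omega

/-- For a transitive `D`, every exponent vector satisfying the inequalities defining the dual
dominates that of an irreducible component of the edge ideal. -/
theorem exists_isMinimalIrreducibleOf_le_of_forall {K : Type*} [Field K]
    (htrans : ∀ i j k : Fin n, D.E i j → D.E j k → i ≠ k → D.E i k) {m : Fin n →₀ ℕ}
    (hm : ∀ i j, D.E i j → 1 ≤ m i ∨ D.d j ≤ m j) :
    ∃ a : Fin n →₀ ℕ, IsMinimalIrreducibleOf (edgeIdeal K D) (pureIdeal K a) ∧ a ≤ m := by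
  classical
  have htr : ∀ i j k : Fin n, D.E i j → D.E j k → D.E i k := fun i j k hij hjk =>
    htrans i j k hij hjk (by rintro rfl; exact D.no_two_cycles _ _ hij hjk)
  -- The vertices outside the support of the component: those where `m` vanishes, and those
  -- where `m` is small whose successors all have large `m`.
  let P : Fin n → Prop := fun j => m j = 0 ∨ (m j < D.d j ∧ ∀ k, D.E j k → D.d k ≤ m k)
  have hP : ∀ j, m j < D.d j → ¬ P j → ∃ k, D.E j k ∧ P k := by
    have : IsTrans (Fin n) (flip D.E) := ⟨fun _ _ _ h₁ h₂ => htr _ _ _ h₂ h₁⟩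
    have : Std.Irrefl (flip D.E) := ⟨D.irrefl⟩
    intro j
    induction j using (Finite.wellFounded_of_trans_of_irrefl (flip D.E)).induction with
    | _ j ih =>
      intro hj hPj
      obtain ⟨k, hjk, hk⟩ : ∃ k, D.E j k ∧ m k < D.d k := by
        by_contra! h
        exact hPj (Or.inr ⟨hj, h⟩)
      by_cases hPk : P k
      · exact ⟨k, hjk, hPk⟩
      · obtain ⟨l, hkl, hPl⟩ := ih k hjk hk hPk
        exact ⟨l, htr _ _ _ hjk hkl, hPl⟩
  let a : Fin n →₀ ℕ := Finsupp.equivFunOnFinite.symm fun i => if P i then 0 else 1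
  have haP : ∀ i, P i → a i = 0 := fun i hi => by simp [a, hi]
  have haN : ∀ i, ¬ P i → a i = 1 := fun i hi => by simp [a, hi]
  have ha : edgeIdeal K D ≤ pureIdeal K a := by
    rw [edgeIdeal_le_pureIdeal_iff]
    intro i j hij
    by_cases hPi : P i
    · have hPj : ¬ P j := by
        have hj : D.d j ≤ m j := by
          rcases hPi with h | h
          · exact (hm i j hij).resolve_left (by omega)
          · exact h.2 j hij
        have := D.dpos j
        rintro (h | h) <;> omega
      rw [haN j hPj]
      exact Or.inr ⟨le_rfl, D.dpos j⟩
    · exact Or.inl (haN i hPi)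
  obtain ⟨c, hc, hca, hcd⟩ := D.exists_isMinimalIrreducibleOf_le ha
  have hcP : ∀ i, P i → c i = 0 := fun i hi => by
    by_contra h
    have := (pureIdeal_le_pureIdeal_iff.1 hca i (by omega)).1
    rw [haP i hi] at this
    omega
  refine ⟨c, hc, fun i => ?_⟩
  by_cases hPi : P i
  · simp [hcP i hPi]
  by_cases hi : m i < D.d i
  · obtain ⟨k, hik, hPk⟩ := hP i hi hPi
    have hci : c i = 1 := (D.edgeIdeal_le_pureIdeal_iff.1 hc.2.1 i k hik).resolve_right
      (by rw [hcP k hPk]; omega)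
    have : m i ≠ 0 := fun h => hPi (Or.inl h)
    omega
  · exact (hcd i).trans (not_lt.1 hi)

end WOG

theorem mem_alexDual_iff {n : ℕ} {K : Type*} [Field K] {I : Ideal (MvPolynomial (Fin n) K)}
    {f : MvPolynomial (Fin n) K} :
    f ∈ alexDual I ↔ ∀ m ∈ f.support, ∃ a : Fin n →₀ ℕ,
      IsMinimalIrreducibleOf I (pureIdeal K a) ∧ a ≤ m := by
  have h : alexDual I = Ideal.span ((fun s => monomial s (1 : K)) ''
      {a | IsMinimalIrreducibleOf I (pureIdeal K a)}) := by
    unfold alexDual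
    congr 1
    ext g
    simp [Set.mem_image, eq_comm]
  rw [h, mem_ideal_span_monomial_image]
  rfl

/-- If `D` is a transitive vertex-weighted oriented graph, then Alexander
duality holds for `I = I(D)`: the dual `I^* = ⋂_{x^a ∈ G(I)} ({x_i^{a_i} : a_i ≥ 1})` equals
the Alexander dual `I^∨`. -/
theorem alexander_duality_of_transitive
    {n : ℕ} (K : Type*) [Field K] (D : WOG n)
    (htrans : ∀ i j k : Fin n, D.E i j → D.E j k → i ≠ k → D.E i k) :
    (⨅ e ∈ {q : Fin n × Fin n | D.E q.1 q.2},
        pureIdeal K (Finsupp.single e.1 1 + Finsupp.single e.2 (D.d e.2)))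
      = alexDual (edgeIdeal K D) := by
  ext f
  have hdual : f ∈ (⨅ e ∈ {q : Fin n × Fin n | D.E q.1 q.2},
      pureIdeal K (Finsupp.single e.1 1 + Finsupp.single e.2 (D.d e.2))) ↔
      ∀ m ∈ f.support, ∀ i j, D.E i j → 1 ≤ m i ∨ D.d j ≤ m j := by
    simp only [Submodule.mem_iInf, mem_pureIdeal_iff]
    constructor
    · intro h m hm i j hij
      exact (exists_le_single_add_single_iff (D.ne_of_edge hij) (D.dpos j)).1 (h (i, j) hij m hm)
    · rintro h ⟨i, j⟩ hij m hm
      exact (exists_le_single_add_single_iff (D.ne_of_edge hij) (D.dpos j)).2 (h m hm i j hij)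
  rw [hdual, mem_alexDual_iff]
  refine forall₂_congr fun m _ => ⟨D.exists_isMinimalIrreducibleOf_le_of_forall htrans, ?_⟩
  rintro ⟨a, ha, ham⟩ i j hij
  exact (D.one_le_or_le_of_isMinimalIrreducibleOf htrans ha hij).imp
    (fun h => h.trans (ham i)) (fun h => h.trans (ham j))
end
end
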